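/- Let n, k, d be positive integers with 2(n+k) ≤ d. Then S_d(n, n+k, d−(n+k)) ⊆ co{ max(0, (6n+4k−2d)/d)·S₂(1) + {a}, (2n/d)·S₂(1) + ({0}×{0}×[0, k/d]) }, where a = (0, min(n, d−2n−2k)/d, (min(n, d−2n−2k) + k)/d). -/

import Mathlib

open Matrix
open scoped Pointwise ComplexOrder

/-- `P` is an orthogonal projection matrix: `P = P† = P²`. -/
def IsProjn {d : ℕ} (P : Matrix (Fin d) (Fin d) ℂ) : Prop :=
  P.IsHermitian ∧ P * P = P

/-- `corrSet d n₁ n₂ n₃` is the set `S_d(n₁,n₂,n₃) ⊆ ℝ³` of triples of normalized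
traces of pairwise products of orthogonal projections of the prescribed ranks. -/
def corrSet (d n₁ n₂ n₃ : ℕ) : Set (ℝ × ℝ × ℝ) :=
  { x | ∃ P₁ P₂ P₃ : Matrix (Fin d) (Fin d) ℂ,
      IsProjn P₁ ∧ IsProjn P₂ ∧ IsProjn P₃ ∧
      P₁.rank = n₁ ∧ P₂.rank = n₂ ∧ P₃.rank = n₃ ∧
      x = ((1 / (d : ℝ)) * ((P₁ * P₂).trace).re,
           (1 / (d : ℝ)) * ((P₁ * P₃).trace).re,
           (1 / (d : ℝ)) * ((P₂ * P₃).trace).re) }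

/-! ### Compactness -/

theorem IsCompact.convexHull_of_finiteDimensional {E : Type*} [NormedAddCommGroup E]
    [NormedSpace ℝ E] [FiniteDimensional ℝ E] {s : Set E} (hs : IsCompact s) :
    IsCompact (convexHull ℝ s) := by
  set N := Module.finrank ℝ E + 1
  have key : convexHull ℝ s =
      (fun p : (Fin N → E) × (Fin N → ℝ) => ∑ i, p.2 i • p.1 i) ''
        ((Set.univ.pi fun _ => s) ×ˢ stdSimplex ℝ (Fin N)) := by
    apply Set.Subset.antisymm
    · intro x hx
      rw [convexHull_eq_union] at hx
      simp only [Set.mem_iUnion] at hx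
      obtain ⟨t, hts, hind, hxt⟩ := hx
      have hcard : t.card ≤ N := by
        have h1 := hind.card_le_finrank_succ
        have h2 := Submodule.finrank_le (vectorSpan ℝ (Set.range ((↑) : t → E)))
        rw [Fintype.card_coe] at h1
        omega
      have hne : t.Nonempty := by
        rw [Finset.nonempty_iff_ne_empty]
        rintro rfl
        simp at hxt
      have : Nonempty t := hne.to_subtype
      obtain ⟨g, hg⟩ : ∃ g : Fin N → t, Function.Surjective g := by
        have e : t ↪ Fin N := (Function.Embedding.nonempty_of_card_le (by simpa using hcard)).some
        exact ⟨Function.invFun e, Function.invFun_surjective e.injective⟩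
      have hrange : (t : Set E) = Set.range (fun i => (g i : E)) := by
        rw [← Function.comp_def, hg.range_comp]
        simp
      rw [hrange, convexHull_range_eq_exists_affineCombination] at hxt
      obtain ⟨u, w, hw0, hw1, rfl⟩ := hxt
      rw [Finset.affineCombination_eq_linear_combination _ _ _ hw1]
      refine ⟨(fun i => (g i : E), fun i => if i ∈ u then w i else 0), ⟨?_, ?_, ?_⟩, ?_⟩
      · intro i _
        exact hts (g i).2
      · intro i
        by_cases hi : i ∈ u
        · simpa [hi] using hw0 i hi
        · simp [hi]
      · simpa using hw1
      · simp [ite_smul]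
    · rintro _ ⟨⟨g, w⟩, ⟨hg, hw0, hw1⟩, rfl⟩
      exact (convex_convexHull ℝ s).sum_mem (fun i _ => hw0 i) hw1
        fun i _ => subset_convexHull ℝ s (hg i trivial)
  rw [key]
  refine ((isCompact_univ_pi fun _ => hs).prod (isCompact_stdSimplex ℝ _)).image ?_
  fun_prop

theorem IsProjn.one_sub {d : ℕ} {P : Matrix (Fin d) (Fin d) ℂ} (hP : IsProjn P) :
    IsProjn (1 - P) :=
  ⟨Matrix.isHermitian_one.sub hP.1, by rw [sub_mul, mul_sub, mul_sub, hP.2]; simp⟩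

theorem IsProjn.norm_entry_le {d : ℕ} {P : Matrix (Fin d) (Fin d) ℂ} (hP : IsProjn P)
    (i j : Fin d) : ‖P i j‖ ≤ 1 := by
  have hU : (2 : ℂ) • P - 1 ∈ Matrix.unitaryGroup (Fin d) ℂ := by
    have hs : star ((2 : ℂ) • P - 1) = (2 : ℂ) • P - 1 := by
      simp [Matrix.star_eq_conjTranspose, hP.1.eq]
    rw [Matrix.mem_unitaryGroup_iff, hs]
    simp only [sub_mul, mul_sub, Matrix.smul_mul, Matrix.mul_smul, hP.2, mul_one, one_mul]
    module
  have hb := entry_norm_bound_of_unitary hU i j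
  have h1 := entry_norm_bound_of_unitary (one_mem (Matrix.unitaryGroup (Fin d) ℂ)) i j
  have h2 : (2 : ℂ) * P i j = ((2 : ℂ) • P - 1) i j + (1 : Matrix (Fin d) (Fin d) ℂ) i j := by
    simp
  have h3 := norm_add_le (((2 : ℂ) • P - 1) i j) ((1 : Matrix (Fin d) (Fin d) ℂ) i j)
  rw [← h2, norm_mul, Complex.norm_ofNat] at h3
  linarith

theorem IsProjn.trace_eq_rank {d : ℕ} {P : Matrix (Fin d) (Fin d) ℂ} (hP : IsProjn P) :
    P.trace = P.rank := by
  have hid : IsIdempotentElem (Matrix.toLin' P) := by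
    rw [IsIdempotentElem, Module.End.mul_eq_comp, ← Matrix.toLin'_mul, hP.2]
  have h := (LinearMap.IsIdempotentElem.isProj_range _ hid).trace
  rw [Matrix.trace_toLin'_eq] at h
  exact h

theorem isCompact_setOf_isProjn_rank (d n : ℕ) :
    IsCompact {P : Matrix (Fin d) (Fin d) ℂ | IsProjn P ∧ P.rank = n} := by
  have hbig : IsCompact {P : Matrix (Fin d) (Fin d) ℂ | ∀ i j, P i j ∈ Metric.closedBall 0 1} := by
    have := isCompact_univ_pi fun _ : Fin d =>
      isCompact_univ_pi fun _ : Fin d => isCompact_closedBall (0 : ℂ) 1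
    refine (congrArg IsCompact (Set.ext fun P => ?_)).mp this
    exact ⟨fun h i j => h i trivial j trivial, fun h i _ j _ => h i j⟩
  refine hbig.of_isClosed_subset ?_ ?_
  · have : {P : Matrix (Fin d) (Fin d) ℂ | IsProjn P ∧ P.rank = n} =
        {P | Pᴴ = P} ∩ {P | P * P = P} ∩ {P | P.trace = (n : ℂ)} := by
      ext P
      constructor
      · rintro ⟨h, hr⟩
        exact ⟨h, by simp [h.trace_eq_rank, hr]⟩
      · rintro ⟨h, hr⟩
        have h' : IsProjn P := h
        refine ⟨h', ?_⟩
        have : (P.rank : ℂ) = n := by rw [← h'.trace_eq_rank]; exact hr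
        exact_mod_cast this
    rw [this]
    refine ((isClosed_eq ?_ ?_).inter (isClosed_eq ?_ ?_)).inter (isClosed_eq ?_ ?_) <;> fun_prop
  · rintro P ⟨hP, _⟩ i j
    simpa using hP.norm_entry_le i j

theorem isCompact_corrSet (d n₁ n₂ n₃ : ℕ) : IsCompact (corrSet d n₁ n₂ n₃) := by
  have h := ((isCompact_setOf_isProjn_rank d n₁).prod
    ((isCompact_setOf_isProjn_rank d n₂).prod (isCompact_setOf_isProjn_rank d n₃))).image
    (f := fun P => ((1 / (d : ℝ)) * ((P.1 * P.2.1).trace).re,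
           (1 / (d : ℝ)) * ((P.1 * P.2.2).trace).re,
           (1 / (d : ℝ)) * ((P.2.1 * P.2.2).trace).re)) (by fun_prop)
  convert h using 1
  ext x
  constructor
  · rintro ⟨P₁, P₂, P₃, h1, h2, h3, r1, r2, r3, rfl⟩
    exact ⟨(P₁, P₂, P₃), ⟨⟨h1, r1⟩, ⟨h2, r2⟩, ⟨h3, r3⟩⟩, rfl⟩
  · rintro ⟨⟨P₁, P₂, P₃⟩, ⟨⟨h1, r1⟩, ⟨h2, r2⟩, ⟨h3, r3⟩⟩, rfl⟩
    exact ⟨P₁, P₂, P₃, h1, h2, h3, r1, r2, r3, rfl⟩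

/-! ### First-order optimality -/

theorem vecMulVec_star_mul_mul_vecMulVec_star {d : ℕ} (A : Matrix (Fin d) (Fin d) ℂ)
    (u : Fin d → ℂ) :
    vecMulVec u (star u) * A * vecMulVec u (star u) =
      (star u ⬝ᵥ A *ᵥ u) • vecMulVec u (star u) := by
  rw [mul_assoc, mul_vecMulVec, vecMulVec_mul_vecMulVec]
  ext i j
  simp [vecMulVec_apply]
  ring

theorem trace_vecMulVec_star_mul {d : ℕ} (A : Matrix (Fin d) (Fin d) ℂ) (u : Fin d → ℂ) :
    (vecMulVec u (star u) * A).trace = star u ⬝ᵥ A *ᵥ u := by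
  rw [Matrix.trace_mul_comm, mul_vecMulVec, trace_vecMulVec, dotProduct_comm]

theorem star_star_dotProduct_mulVec {d : ℕ} (A : Matrix (Fin d) (Fin d) ℂ)
    (u w : Fin d → ℂ) : star (star u ⬝ᵥ A *ᵥ w) = star w ⬝ᵥ Aᴴ *ᵥ u := by
  rw [star_dotProduct, star_star, star_mulVec, dotProduct_mulVec]

/-- The expectation inequality obtained by comparing `P` with its image under the
reflection along `u`. -/
theorem quadForm_mul_le_of_reflection_le {d : ℕ} {P H : Matrix (Fin d) (Fin d) ℂ}
    (hP : P.IsHermitian) (hH : H.IsHermitian)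
    (hmax : ∀ R : Matrix (Fin d) (Fin d) ℂ, R.IsHermitian → R * R = 1 →
      (R * P * R * H).trace.re ≤ (P * H).trace.re) (u : Fin d → ℂ) :
    (star u ⬝ᵥ P *ᵥ u).re * (star u ⬝ᵥ H *ᵥ u).re ≤
      (star u ⬝ᵥ u).re * (star u ⬝ᵥ (P * H) *ᵥ u).re := by
  by_cases hu : u = 0
  · simp [hu]
  have hpos : 0 < star u ⬝ᵥ u := dotProduct_star_self_pos_iff.mpr hu
  obtain ⟨hn, him⟩ := Complex.lt_def.mp hpos
  set n : ℝ := (star u ⬝ᵥ u).re with hn_def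
  have hN : star u ⬝ᵥ u = (n : ℂ) := Complex.ext rfl (by simpa using him.symm)
  replace hn : 0 < n := hn
  have hn0 : (n : ℂ) ≠ 0 := by exact_mod_cast hn.ne'
  set K := vecMulVec u (star u) with hK
  have hKherm : Kᴴ = K := by simp [hK, conjTranspose_vecMulVec]
  have hKK : K * K = (n : ℂ) • K := by
    have := vecMulVec_star_mul_mul_vecMulVec_star 1 u
    rwa [mul_one, one_mulVec, hN] at this
  set c : ℂ := ((2 / n : ℝ) : ℂ) with hc
  have hcn : c * n = 2 := by rw [hc]; push_cast; field_simp
  have hKPK : K * P * K = (star u ⬝ᵥ P *ᵥ u) • K := vecMulVec_star_mul_mul_vecMulVec_star P u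
  have hR := hmax (1 - c • K)
    (by
      show (1 - c • K)ᴴ = _
      rw [conjTranspose_sub, conjTranspose_smul, hKherm, conjTranspose_one, hc]
      simp)
    (by
      have h4 : (c * c * n) = 2 * c := by rw [mul_assoc, hcn]; ring
      simp only [sub_mul, mul_sub, Matrix.smul_mul, Matrix.mul_smul, hKK, mul_one, one_mul,
        smul_smul, ← mul_assoc, h4]
      module)
  have hexp : (1 - c • K) * P * (1 - c • K) * H =
      P * H - c • (K * (P * H)) - c • (P * K * H) + (c * c) • (K * P * K * H) := by
    simp only [sub_mul, mul_sub, Matrix.smul_mul, Matrix.mul_smul, mul_one, one_mul, smul_smul,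
      mul_assoc]
    module
  have hswap : (P * K * H).trace = star (star u ⬝ᵥ (P * H) *ᵥ u) := by
    rw [mul_assoc, Matrix.trace_mul_comm, mul_assoc, trace_vecMulVec_star_mul,
      star_star_dotProduct_mulVec, conjTranspose_mul, hP.eq, hH.eq]
  rw [hexp, hKPK] at hR
  simp only [Matrix.trace_add, Matrix.trace_sub, Matrix.trace_smul, Matrix.smul_mul, hswap] at hR
  rw [hK, trace_vecMulVec_star_mul, trace_vecMulVec_star_mul] at hR
  have hPim : (star u ⬝ᵥ P *ᵥ u).im = 0 := hP.im_star_dotProduct_mulVec_self u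
  have hHim : (star u ⬝ᵥ H *ᵥ u).im = 0 := hH.im_star_dotProduct_mulVec_self u
  simp only [hc, smul_eq_mul, Complex.add_re, Complex.sub_re, Complex.mul_re, Complex.ofReal_re,
    Complex.ofReal_im, Complex.mul_im, hPim, hHim, Complex.star_def, Complex.conj_re, zero_mul,
    mul_zero, sub_zero, add_zero] at hR
  set x := (star u ⬝ᵥ P *ᵥ u).re
  set y := (star u ⬝ᵥ H *ᵥ u).re
  set z := (star u ⬝ᵥ (P * H) *ᵥ u).re
  have h1 : 2 / n * (2 / n) * (x * y) ≤ 2 / n * (2 / n) * (n * z) := by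
    have : 2 / n * (2 / n) * (n * z) = 2 / n * z + 2 / n * z := by field_simp; ring
    linarith
  exact le_of_mul_le_mul_left h1 (by positivity)

theorem IsProjn.commute_of_reflection_le {d : ℕ} {P H : Matrix (Fin d) (Fin d) ℂ}
    (hP : IsProjn P) (hH : H.IsHermitian)
    (hmax : ∀ R : Matrix (Fin d) (Fin d) ℂ, R.IsHermitian → R * R = 1 →
      (R * P * R * H).trace.re ≤ (P * H).trace.re) : P * H = H * P := by
  have key : ∀ x : Fin d → ℂ, (1 - P) *ᵥ H *ᵥ P *ᵥ x = 0 := by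
    intro x
    set v := P *ᵥ x with hv
    set z := (1 - P) *ᵥ H *ᵥ v with hz
    have hPv : P *ᵥ v = v := by rw [hv, mulVec_mulVec, hP.2]
    have hPz : P *ᵥ z = 0 := by
      rw [hz, mulVec_mulVec, mul_sub, hP.2, mul_one, sub_self, zero_mulVec]
    have hvz : star v ⬝ᵥ z = 0 := by
      rw [← hPv, star_mulVec, hP.1.eq, ← dotProduct_mulVec, hPz, dotProduct_zero]
    have hzv : star z ⬝ᵥ v = 0 := by
      rw [← hPv, dotProduct_mulVec, ← hP.1.eq, ← star_mulVec, hPz, star_zero, zero_dotProduct]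
    have hzHv : star z ⬝ᵥ H *ᵥ v = star z ⬝ᵥ z := by
      have : H *ᵥ v = z + P *ᵥ H *ᵥ v := by rw [hz, sub_mulVec, one_mulVec]; simp
      rw [this, dotProduct_add, dotProduct_mulVec (star z) P, ← hP.1.eq, ← star_mulVec, hPz]
      simp
    have hvHz : star v ⬝ᵥ H *ᵥ z = star z ⬝ᵥ z := by
      rw [← star_star (star v ⬝ᵥ H *ᵥ z), star_star_dotProduct_mulVec, hH.eq, hzHv,
        ← star_dotProduct]
    have hineq : ∀ t : ℝ, 0 < t → (star v ⬝ᵥ v).re * (star z ⬝ᵥ z).re ≤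
        t * ((star z ⬝ᵥ z).re * (star v ⬝ᵥ H *ᵥ v).re
          - (star v ⬝ᵥ v).re * (star z ⬝ᵥ H *ᵥ z).re) + t ^ 2 * (star z ⬝ᵥ z).re ^ 2 := by
      intro t ht
      have hq := quadForm_mul_le_of_reflection_le hP.1 hH hmax (v + (t : ℂ) • z)
      have hPu : P *ᵥ (v + (t : ℂ) • z) = v := by
        rw [mulVec_add, mulVec_smul, hPv, hPz, smul_zero, add_zero]
      have hPHu : star (v + (t : ℂ) • z) ⬝ᵥ (P * H) *ᵥ (v + (t : ℂ) • z) =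
          star v ⬝ᵥ H *ᵥ (v + (t : ℂ) • z) := by
        rw [← mulVec_mulVec, dotProduct_mulVec _ P, ← hP.1.eq, ← star_mulVec, hPu]
      rw [hPHu, hPu] at hq
      simp only [star_add, star_smul, mulVec_add, mulVec_smul, add_dotProduct, dotProduct_add,
        smul_dotProduct, dotProduct_smul, hvz, hzv, hzHv, hvHz, smul_eq_mul, Complex.star_def,
        Complex.conj_ofReal, mul_zero, add_zero, zero_add, Complex.add_re,
        Complex.re_ofReal_mul] at hq
      refine le_of_mul_le_mul_left ?_ ht
      nlinarith [hq]
    have hlim : (star v ⬝ᵥ v).re * (star z ⬝ᵥ z).re ≤ 0 := by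
      have htend : Filter.Tendsto (fun t : ℝ => t * ((star z ⬝ᵥ z).re * (star v ⬝ᵥ H *ᵥ v).re
          - (star v ⬝ᵥ v).re * (star z ⬝ᵥ H *ᵥ z).re) + t ^ 2 * (star z ⬝ᵥ z).re ^ 2)
          (nhdsWithin 0 (Set.Ioi 0)) (nhds 0) := by
        refine tendsto_nhdsWithin_of_tendsto_nhds ?_
        refine Continuous.tendsto' (by fun_prop) _ _ (by simp)
      exact ge_of_tendsto htend (by filter_upwards [self_mem_nhdsWithin] with t ht using hineq t ht)
    by_contra hz0
    have hv0 : v ≠ 0 := by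
      intro h0
      apply hz0
      simp [hz, h0]
    have h1 := (Complex.lt_def.mp (dotProduct_star_self_pos_iff.mpr hz0)).1
    have h2 := (Complex.lt_def.mp (dotProduct_star_self_pos_iff.mpr hv0)).1
    exact absurd hlim (not_le.mpr (mul_pos h2 h1))
  have hmat : (1 - P) * H * P = 0 := by
    apply Matrix.ext_of_mulVec_single
    intro i
    rw [zero_mulVec, ← mulVec_mulVec, ← mulVec_mulVec, key]
  have h1 : H * P = P * H * P := by
    rw [sub_mul, sub_mul, one_mul, sub_eq_zero] at hmat
    exact hmat
  have h2 := congrArg conjTranspose h1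
  simp only [conjTranspose_mul, hP.1.eq, hH.eq] at h2
  rw [h2, ← mul_assoc, ← h1]

/-! ### Invariant subspaces of dimension at most two -/

theorem exists_isometry_of_submodule {d : ℕ} (V : Submodule ℂ (Fin d → ℂ)) :
    ∃ B : Matrix (Fin d) (Fin (Module.finrank ℂ V)) ℂ,
      Bᴴ * B = 1 ∧ (∀ c, B *ᵥ c ∈ V) ∧ ∀ v ∈ V, (B * Bᴴ) *ᵥ v = v := by
  set e := (WithLp.linearEquiv 2 ℂ (Fin d → ℂ)).symm
  set V' : Submodule ℂ (EuclideanSpace ℂ (Fin d)) := V.map e.toLinearMap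
  have hfin : Module.finrank ℂ V' = Module.finrank ℂ V := LinearEquiv.finrank_map_eq e V
  set b : OrthonormalBasis (Fin (Module.finrank ℂ V)) ℂ V' :=
    (stdOrthonormalBasis ℂ V').reindex (finCongr hfin)
  set B : Matrix (Fin d) (Fin (Module.finrank ℂ V)) ℂ :=
    Matrix.of fun i j => (b j : EuclideanSpace ℂ (Fin d)) i with hB
  have hBc : ∀ c, e (B *ᵥ c) = ((∑ j, c j • b j : V') : EuclideanSpace ℂ (Fin d)) := by
    intro c
    ext i
    simp [e, hB, mulVec, dotProduct, mul_comm]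
  have hiso : Bᴴ * B = 1 := by
    ext j k
    have h := orthonormal_iff_ite.mp b.orthonormal j k
    rw [Submodule.coe_inner, PiLp.inner_apply] at h
    rw [Matrix.mul_apply, Matrix.one_apply, ← h]
    simp [hB, mul_comm]
  refine ⟨B, hiso, ?_, ?_⟩
  · intro c
    have h : e (B *ᵥ c) ∈ V' := by
      rw [hBc]
      exact Submodule.coe_mem _
    obtain ⟨v, hv, hve⟩ := h
    rwa [← e.injective hve]
  · intro v hv
    have hv' : e v ∈ V' := Submodule.mem_map_of_mem hv
    obtain ⟨c, hc⟩ : ∃ c, B *ᵥ c = v := by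
      refine ⟨b.repr ⟨e v, hv'⟩, e.injective ?_⟩
      rw [hBc, b.sum_repr]
    rw [← hc, mulVec_mulVec, Matrix.mul_assoc, hiso, Matrix.mul_one]

theorem exists_eigenvector_mem {d : ℕ} {W : Submodule ℂ (Fin d → ℂ)} (hW : W ≠ ⊥)
    (A : Matrix (Fin d) (Fin d) ℂ) (hA : ∀ v ∈ W, A *ᵥ v ∈ W) :
    ∃ v ∈ W, v ≠ 0 ∧ ∃ μ : ℂ, A *ᵥ v = μ • v := by
  have : Nontrivial W := Submodule.nontrivial_iff_ne_bot.mpr hW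
  obtain ⟨μ, hμ⟩ := Module.End.exists_eigenvalue
    ((Matrix.toLin' A).restrict (p := W) (q := W) fun v hv => by simpa using hA v hv)
  obtain ⟨v, hv⟩ := hμ.exists_hasEigenvector
  refine ⟨v, v.2, fun h => hv.2 (Subtype.ext h), μ, ?_⟩
  simpa using congrArg Subtype.val hv.apply_eq_smul

/-- Two projections have, inside any nonzero jointly invariant subspace, a jointly invariant
subspace of dimension one or two. -/
theorem exists_invariant_submodule_of_projn {d : ℕ} {P₁ P₂ : Matrix (Fin d) (Fin d) ℂ}
    (h₁ : P₁ * P₁ = P₁) (h₂ : P₂ * P₂ = P₂) {W : Submodule ℂ (Fin d → ℂ)} (hW : W ≠ ⊥)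
    (hW₁ : ∀ v ∈ W, P₁ *ᵥ v ∈ W) (hW₂ : ∀ v ∈ W, P₂ *ᵥ v ∈ W) :
    ∃ V ≤ W, V ≠ ⊥ ∧ Module.finrank ℂ V ≤ 2 ∧
      (∀ v ∈ V, P₁ *ᵥ v ∈ V) ∧ ∀ v ∈ V, P₂ *ᵥ v ∈ V := by
  have hrefl : ∀ P : Matrix (Fin d) (Fin d) ℂ, P * P = P → ∀ v : Fin d → ℂ,
      ((2 : ℂ) • P - 1) *ᵥ ((2 : ℂ) • P - 1) *ᵥ v = v := by
    intro P hP v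
    have : ((2 : ℂ) • P - 1) * ((2 : ℂ) • P - 1) = 1 := by
      simp only [sub_mul, mul_sub, Matrix.smul_mul, Matrix.mul_smul, hP, mul_one, one_mul]
      module
    rw [mulVec_mulVec, this, one_mulVec]
  have happ : ∀ (P : Matrix (Fin d) (Fin d) ℂ) (v : Fin d → ℂ),
      ((2 : ℂ) • P - 1) *ᵥ v = (2 : ℂ) • P *ᵥ v - v := by
    intro P v
    rw [sub_mulVec, smul_mulVec, one_mulVec]
  obtain ⟨v, hvW, hv0, μ, hμ⟩ := exists_eigenvector_mem hW
    (((2 : ℂ) • P₁ - 1) * ((2 : ℂ) • P₂ - 1)) (by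
      intro v hv
      rw [← mulVec_mulVec, happ, happ]
      have := W.sub_mem (W.smul_mem 2 (hW₂ v hv)) hv
      exact W.sub_mem (W.smul_mem 2 (hW₁ _ this)) this)
  rw [← mulVec_mulVec] at hμ
  have hB : ((2 : ℂ) • P₂ - 1) *ᵥ v = μ • ((2 : ℂ) • P₁ - 1) *ᵥ v := by
    rw [← mulVec_smul, ← hμ, hrefl P₁ h₁]
  have hBA : v = μ • ((2 : ℂ) • P₂ - 1) *ᵥ ((2 : ℂ) • P₁ - 1) *ᵥ v := by
    rw [← mulVec_smul, ← mulVec_smul, ← hμ, hrefl P₁ h₁, hrefl P₂ h₂]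
  have hμ0 : μ ≠ 0 := by
    rintro rfl
    exact hv0 (by simpa using hBA)
  have hBA' : ((2 : ℂ) • P₂ - 1) *ᵥ ((2 : ℂ) • P₁ - 1) *ᵥ v = μ⁻¹ • v := by
    conv_rhs => rw [hBA]
    rw [smul_smul, inv_mul_cancel₀ hμ0, one_smul]
  rw [happ, happ] at hB
  rw [happ, happ, mulVec_sub, mulVec_smul] at hBA'
  set V := Submodule.span ℂ (Set.range ![v, P₁ *ᵥ v]) with hV
  have hv : v ∈ V := Submodule.subset_span ⟨0, rfl⟩
  have hPv : P₁ *ᵥ v ∈ V := Submodule.subset_span ⟨1, rfl⟩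
  have hP2v : P₂ *ᵥ v ∈ V := by
    have : P₂ *ᵥ v = (1 / 2 : ℂ) • (v + μ • ((2 : ℂ) • P₁ *ᵥ v - v)) := by
      rw [← hB]
      module
    rw [this]
    exact V.smul_mem _ (V.add_mem hv (V.smul_mem _ (V.sub_mem (V.smul_mem _ hPv) hv)))
  have hP21v : P₂ *ᵥ P₁ *ᵥ v ∈ V := by
    have : P₂ *ᵥ P₁ *ᵥ v =
        (1 / 4 : ℂ) • (μ⁻¹ • v + ((2 : ℂ) • P₁ *ᵥ v - v) + (2 : ℂ) • P₂ *ᵥ v) := by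
      rw [← hBA']
      module
    rw [this]
    exact V.smul_mem _ (V.add_mem (V.add_mem (V.smul_mem _ hv)
      (V.sub_mem (V.smul_mem _ hPv) hv)) (V.smul_mem _ hP2v))
  have hinv : ∀ P : Matrix (Fin d) (Fin d) ℂ, P *ᵥ v ∈ V → P *ᵥ P₁ *ᵥ v ∈ V →
      ∀ x ∈ V, P *ᵥ x ∈ V := by
    intro P ha hb
    have hle : V ≤ V.comap (Matrix.toLin' P) := by
      rw [hV, Submodule.span_le]
      rintro _ ⟨i, rfl⟩
      fin_cases i
      · exact ha
      · exact hb
    intro x hx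
    simpa using hle hx
  refine ⟨V, ?_, ?_, ?_, hinv P₁ hPv ?_, hinv P₂ hP2v hP21v⟩
  · rw [hV, Submodule.span_le]
    rintro _ ⟨i, rfl⟩
    fin_cases i
    · exact hvW
    · exact hW₁ v hvW
  · exact fun h => hv0 ((Submodule.eq_bot_iff V).mp h v hv)
  · exact (finrank_range_le_card (R := ℂ) ![v, P₁ *ᵥ v]).trans (by simp)
  · rwa [mulVec_mulVec, h₁]

/-- Three projections some linear combination of which is central have, inside the range of any
nonzero projection commuting with them, a jointly invariant subspace of dimension one or two. -/
theorem exists_invariant_submodule_of_central {d : ℕ} {P₁ P₂ P₃ Q : Matrix (Fin d) (Fin d) ℂ}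
    (h₁ : P₁ * P₁ = P₁) (h₂ : P₂ * P₂ = P₂) {w₁ w₂ w₃ : ℂ} (hw : w₃ ≠ 0)
    (hX₁ : Commute (w₁ • P₁ + w₂ • P₂ + w₃ • P₃) P₁)
    (hX₂ : Commute (w₁ • P₁ + w₂ • P₂ + w₃ • P₃) P₂)
    (hQ : Q * Q = Q) (hQ0 : Q ≠ 0) (hQ₁ : Commute Q P₁) (hQ₂ : Commute Q P₂)
    (hQ₃ : Commute Q P₃) :
    ∃ V : Submodule ℂ (Fin d → ℂ), V ≠ ⊥ ∧ Module.finrank ℂ V ≤ 2 ∧ (∀ v ∈ V, Q *ᵥ v = v) ∧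
      (∀ v ∈ V, P₁ *ᵥ v ∈ V) ∧ (∀ v ∈ V, P₂ *ᵥ v ∈ V) ∧ ∀ v ∈ V, P₃ *ᵥ v ∈ V := by
  set X := w₁ • P₁ + w₂ • P₂ + w₃ • P₃ with hX
  have hQX : Commute Q X :=
    ((hQ₁.smul_right _).add_right (hQ₂.smul_right _)).add_right (hQ₃.smul_right _)
  set W₁ : Submodule ℂ (Fin d → ℂ) := LinearMap.eqLocus (Matrix.toLin' Q) LinearMap.id
  have hmem₁ : ∀ v, v ∈ W₁ ↔ Q *ᵥ v = v := fun v => by simp [W₁, LinearMap.mem_eqLocus]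
  have hW₁ : W₁ ≠ ⊥ := by
    intro hbot
    apply hQ0
    apply Matrix.ext_of_mulVec_single
    intro i
    rw [zero_mulVec]
    refine (Submodule.eq_bot_iff W₁).mp hbot _ ((hmem₁ _).mpr ?_)
    rw [mulVec_mulVec, hQ]
  obtain ⟨v, hvW, hv0, ξ, hξ⟩ := exists_eigenvector_mem hW₁ X (by
    intro v hv
    rw [hmem₁] at hv ⊢
    rw [mulVec_mulVec, hQX.eq, ← mulVec_mulVec, hv])
  set W₂ : Submodule ℂ (Fin d → ℂ) :=
    W₁ ⊓ LinearMap.eqLocus (Matrix.toLin' X) (ξ • LinearMap.id)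
  have hmem₂ : ∀ v, v ∈ W₂ ↔ Q *ᵥ v = v ∧ X *ᵥ v = ξ • v := fun v => by
    simp [W₂, hmem₁, LinearMap.mem_eqLocus]
  have hW₂ : W₂ ≠ ⊥ := fun h =>
    hv0 ((Submodule.eq_bot_iff W₂).mp h v ((hmem₂ v).mpr ⟨(hmem₁ v).mp hvW, hξ⟩))
  have hinv : ∀ P, Commute Q P → Commute X P → ∀ v ∈ W₂, P *ᵥ v ∈ W₂ := by
    intro P hQP hXP v hv
    obtain ⟨ha, hb⟩ := (hmem₂ v).mp hv
    refine (hmem₂ _).mpr ⟨?_, ?_⟩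
    · rw [mulVec_mulVec, hQP.eq, ← mulVec_mulVec, ha]
    · rw [mulVec_mulVec, hXP.eq, ← mulVec_mulVec, hb, mulVec_smul]
  obtain ⟨V, hVW, hV0, hV2, hV₁, hV₂⟩ := exists_invariant_submodule_of_projn h₁ h₂ hW₂
    (hinv P₁ hQ₁ hX₁) (hinv P₂ hQ₂ hX₂)
  refine ⟨V, hV0, hV2, fun v hv => ((hmem₂ v).mp (hVW hv)).1, hV₁, hV₂, fun v hv => ?_⟩
  have hXv := ((hmem₂ v).mp (hVW hv)).2
  have hP₃ : P₃ *ᵥ v = w₃⁻¹ • (ξ • v - w₁ • P₁ *ᵥ v - w₂ • P₂ *ᵥ v) := by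
    rw [← hXv, hX, add_mulVec, add_mulVec, smul_mulVec, smul_mulVec, smul_mulVec,
      add_sub_right_comm, add_sub_cancel_left, add_sub_cancel_left, smul_smul,
      inv_mul_cancel₀ hw, one_smul]
  rw [hP₃]
  exact V.smul_mem _ (V.sub_mem (V.sub_mem (V.smul_mem _ hv) (V.smul_mem _ (hV₁ v hv)))
    (V.smul_mem _ (hV₂ v hv)))

/-! ### Block decomposition -/

/-- The weighted sum of pairwise overlaps `α Tr P₁P₂ + β Tr P₁P₃ + γ Tr P₂P₃`, compressed
by `Q`. -/
def overlapSum (α β γ : ℝ) {d : ℕ} (Q P₁ P₂ P₃ : Matrix (Fin d) (Fin d) ℂ) : ℝ :=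
  α * (Q * (P₁ * P₂)).trace.re + β * (Q * (P₁ * P₃)).trace.re + γ * (Q * (P₂ * P₃)).trace.re

/-- Numerical data of a direct sum of blocks: `s` two-dimensional blocks carrying three rank-one
projections, each contributing at most `M` to the overlap sum, and `c i j k` one-dimensional
blocks on which the projections take the values `i, j, k`. The parameters `t, n₁, n₂, n₃` are the
total dimension and the three ranks, and `F` is a lower bound for the total contribution. -/
def BlockBound (α β γ M t n₁ n₂ n₃ F : ℝ) : Prop :=
  ∃ (s : ℝ) (c : Fin 2 → Fin 2 → Fin 2 → ℝ), 0 ≤ s ∧ (∀ i j k, 0 ≤ c i j k) ∧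
    t = 2 * s + c 0 0 0 + c 0 0 1 + c 0 1 0 + c 0 1 1 + c 1 0 0 + c 1 0 1 + c 1 1 0 + c 1 1 1 ∧
    n₁ = s + c 1 0 0 + c 1 0 1 + c 1 1 0 + c 1 1 1 ∧
    n₂ = s + c 0 1 0 + c 0 1 1 + c 1 1 0 + c 1 1 1 ∧
    n₃ = s + c 0 0 1 + c 0 1 1 + c 1 0 1 + c 1 1 1 ∧
    F ≤ s * M + c 1 1 1 * (α + β + γ) + c 1 1 0 * α + c 1 0 1 * β + c 0 1 1 * γ

theorem BlockBound.add {α β γ M t n₁ n₂ n₃ F t' n₁' n₂' n₃' F' : ℝ}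
    (h : BlockBound α β γ M t n₁ n₂ n₃ F) (h' : BlockBound α β γ M t' n₁' n₂' n₃' F') :
    BlockBound α β γ M (t + t') (n₁ + n₁') (n₂ + n₂') (n₃ + n₃') (F + F') := by
  obtain ⟨s, c, hs, hc, h1, h2, h3, h4, h5⟩ := h
  obtain ⟨s', c', hs', hc', h1', h2', h3', h4', h5'⟩ := h'
  refine ⟨s + s', fun i j k => c i j k + c' i j k, add_nonneg hs hs',
    fun i j k => add_nonneg (hc i j k) (hc' i j k), ?_, ?_, ?_, ?_, ?_⟩ <;> linarith

theorem IsProjn.trace_mul_re_nonneg {d : ℕ} {P Q : Matrix (Fin d) (Fin d) ℂ}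
    (hP : IsProjn P) (hQ : IsProjn Q) : 0 ≤ (P * Q).trace.re := by
  have h : (P * Q).trace = ((P * Q)ᴴ * (P * Q)).trace := by
    rw [conjTranspose_mul, hP.1.eq, hQ.1.eq, mul_assoc, ← mul_assoc P P Q, hP.2,
      Matrix.trace_mul_comm Q, mul_assoc, hQ.2]
  rw [h]
  exact (Complex.le_def.mp (Matrix.posSemidef_conjTranspose_mul_self (P * Q)).trace_nonneg).1

theorem IsProjn.eq_zero_of_trace_re_nonpos {d : ℕ} {P : Matrix (Fin d) (Fin d) ℂ}
    (hP : IsProjn P) (h : P.trace.re ≤ 0) : P = 0 := by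
  rw [hP.trace_eq_rank, Complex.natCast_re] at h
  rw [← Matrix.trace_conjTranspose_mul_self_eq_zero_iff, hP.1.eq, hP.2, hP.trace_eq_rank]
  exact_mod_cast le_antisymm h (Nat.cast_nonneg _)

/-- The joint counts of three projections, one of which is scalar. -/
theorem blockBound_of_trivial (α β γ M : ℝ) {d : ℕ} {P₁ P₂ P₃ : Matrix (Fin d) (Fin d) ℂ}
    (h₁ : IsProjn P₁) (h₂ : IsProjn P₂) (h₃ : IsProjn P₃)
    (h : (P₁ = 0 ∨ P₁ = 1) ∨ (P₂ = 0 ∨ P₂ = 1) ∨ P₃ = 0 ∨ P₃ = 1) :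
    BlockBound α β γ M d P₁.trace.re P₂.trace.re P₃.trace.re (overlapSum α β γ 1 P₁ P₂ P₃) := by
  set q : Fin 2 → Matrix (Fin d) (Fin d) ℂ → Matrix (Fin d) (Fin d) ℂ :=
    fun i P => if i = 0 then 1 - P else P with hq
  have hqP : ∀ i P, IsProjn P → IsProjn (q i P) := by
    intro i P hP
    by_cases hi : i = 0
    · simpa [hq, hi] using hP.one_sub
    · simpa [hq, hi] using hP
  have hqt : ∀ i P, P = 0 ∨ P = 1 → q i P = 0 ∨ q i P = 1 := by
    rintro i P (rfl | rfl) <;> by_cases hi : i = 0 <;> simp [hq, hi]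
  refine ⟨0, fun i j k => (q i P₁ * q j P₂ * q k P₃).trace.re, le_rfl, ?_, ?_, ?_, ?_, ?_, ?_⟩
  · intro i j k
    rcases h with h | h | h
    · rcases hqt i P₁ h with h | h
      · simp [h]
      · simpa [h] using (hqP j _ h₂).trace_mul_re_nonneg (hqP k _ h₃)
    · rcases hqt j P₂ h with h | h
      · simp [h]
      · simpa [h] using (hqP i _ h₁).trace_mul_re_nonneg (hqP k _ h₃)
    · rcases hqt k P₃ h with h | h
      · simp [h]
      · simpa [h] using (hqP i _ h₁).trace_mul_re_nonneg (hqP j _ h₂)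
  all_goals
    simp [hq, overlapSum, mul_sub, sub_mul]
    try ring_nf
  all_goals exact le_rfl

theorem IsProjn.eq_one_of_rank_eq {d : ℕ} {P : Matrix (Fin d) (Fin d) ℂ}
    (hP : IsProjn P) (h : P.rank = d) : P = 1 := by
  have h0 : 1 - P = 0 := hP.one_sub.eq_zero_of_trace_re_nonpos (by
    rw [Matrix.trace_sub, hP.trace_eq_rank, h]
    simp)
  rw [sub_eq_zero] at h0
  exact h0.symm

theorem IsProjn.eq_zero_of_rank_eq {d : ℕ} {P : Matrix (Fin d) (Fin d) ℂ}
    (hP : IsProjn P) (h : P.rank = 0) : P = 0 :=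
  hP.eq_zero_of_trace_re_nonpos (by simp [hP.trace_eq_rank, h])

theorem blockBound_of_le_two {α β γ M : ℝ}
    (hM : ∀ p₁ p₂ p₃ : Matrix (Fin 2) (Fin 2) ℂ, IsProjn p₁ → IsProjn p₂ → IsProjn p₃ →
      p₁.rank = 1 → p₂.rank = 1 → p₃.rank = 1 → overlapSum α β γ 1 p₁ p₂ p₃ ≤ M)
    {m : ℕ} (hm : m ≤ 2) {P₁ P₂ P₃ : Matrix (Fin m) (Fin m) ℂ}
    (h₁ : IsProjn P₁) (h₂ : IsProjn P₂) (h₃ : IsProjn P₃) :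
    BlockBound α β γ M m P₁.trace.re P₂.trace.re P₃.trace.re (overlapSum α β γ 1 P₁ P₂ P₃) := by
  by_cases h : (P₁ = 0 ∨ P₁ = 1) ∨ (P₂ = 0 ∨ P₂ = 1) ∨ P₃ = 0 ∨ P₃ = 1
  · exact blockBound_of_trivial α β γ M h₁ h₂ h₃ h
  have hrank : ∀ P : Matrix (Fin m) (Fin m) ℂ, IsProjn P → ¬(P = 0 ∨ P = 1) →
      m = 2 ∧ P.rank = 1 := by
    intro P hP hP'
    have ha : P.rank ≠ 0 := fun h => hP' (Or.inl (hP.eq_zero_of_rank_eq h))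
    have hb : P.rank ≠ m := fun h => hP' (Or.inr (hP.eq_one_of_rank_eq h))
    have hc : P.rank ≤ m := P.rank_le_width
    omega
  obtain ⟨t₁, t⟩ := not_or.mp h
  obtain ⟨t₂, t₃⟩ := not_or.mp t
  obtain ⟨rfl, r₁⟩ := hrank P₁ h₁ t₁
  have r₂ := (hrank P₂ h₂ t₂).2
  have r₃ := (hrank P₃ h₃ t₃).2
  refine ⟨1, fun _ _ _ => 0, zero_le_one, fun _ _ _ => le_rfl, ?_, ?_, ?_, ?_, ?_⟩
  · simp
  · simp [h₁.trace_eq_rank, r₁]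
  · simp [h₂.trace_eq_rank, r₂]
  · simp [h₃.trace_eq_rank, r₃]
  · simpa using hM P₁ P₂ P₃ h₁ h₂ h₃ r₁ r₂ r₃

theorem blockBound_of_central {α β γ M : ℝ}
    (hM : ∀ p₁ p₂ p₃ : Matrix (Fin 2) (Fin 2) ℂ, IsProjn p₁ → IsProjn p₂ → IsProjn p₃ →
      p₁.rank = 1 → p₂.rank = 1 → p₃.rank = 1 → overlapSum α β γ 1 p₁ p₂ p₃ ≤ M)
    {d : ℕ} {P₁ P₂ P₃ : Matrix (Fin d) (Fin d) ℂ}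
    (h₁ : IsProjn P₁) (h₂ : IsProjn P₂) (h₃ : IsProjn P₃) {w₁ w₂ w₃ : ℂ} (hw : w₃ ≠ 0)
    (hX₁ : Commute (w₁ • P₁ + w₂ • P₂ + w₃ • P₃) P₁)
    (hX₂ : Commute (w₁ • P₁ + w₂ • P₂ + w₃ • P₃) P₂)
    (N : ℕ) {Q : Matrix (Fin d) (Fin d) ℂ} (hQ : IsProjn Q) (hQ₁ : Commute Q P₁)
    (hQ₂ : Commute Q P₂) (hQ₃ : Commute Q P₃) (hN : Q.trace.re ≤ N) :
    BlockBound α β γ M Q.trace.re (Q * P₁).trace.re (Q * P₂).trace.re (Q * P₃).trace.re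
      (overlapSum α β γ Q P₁ P₂ P₃) := by
  induction N generalizing Q with
  | zero =>
    have hQ0 := hQ.eq_zero_of_trace_re_nonpos (by simpa using hN)
    refine ⟨0, fun _ _ _ => 0, le_rfl, fun _ _ _ => le_rfl, ?_⟩
    simp [hQ0, overlapSum]
  | succ N ih =>
    by_cases hQ0 : Q = 0
    · refine ⟨0, fun _ _ _ => 0, le_rfl, fun _ _ _ => le_rfl, ?_⟩
      simp [hQ0, overlapSum]
    obtain ⟨V, hV0, hV2, hVQ, hV₁, hV₂, hV₃⟩ :=
      exists_invariant_submodule_of_central h₁.2 h₂.2 hw hX₁ hX₂ hQ.2 hQ0 hQ₁ hQ₂ hQ₃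
    obtain ⟨B, hB, hBV, hVB⟩ := exists_isometry_of_submodule V
    have hm1 : 1 ≤ Module.finrank ℂ V := Submodule.one_le_finrank_iff.mpr hV0
    generalize Module.finrank ℂ V = m at B hB hBV hVB hV2 hm1
    set R := B * Bᴴ with hR
    have hRP : IsProjn R := by
      refine ⟨Matrix.isHermitian_mul_conjTranspose_self B, ?_⟩
      rw [hR, Matrix.mul_assoc, ← Matrix.mul_assoc Bᴴ, hB, Matrix.one_mul]
    have hcol : ∀ A : Matrix (Fin d) (Fin d) ℂ, (∀ v ∈ V, A *ᵥ v ∈ V) → R * (A * B) = A * B := by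
      intro A hA
      apply Matrix.ext_of_mulVec_single
      intro i
      rw [← mulVec_mulVec, hVB]
      rw [← mulVec_mulVec]
      exact hA _ (hBV _)
    have hcomm : ∀ A : Matrix (Fin d) (Fin d) ℂ, A.IsHermitian → (∀ v ∈ V, A *ᵥ v ∈ V) →
        Commute R A := by
      intro A hA hAV
      have h1 : R * A * R = A * R := by
        have := congrArg (· * Bᴴ) (hcol A hAV)
        simpa only [hR, Matrix.mul_assoc] using this
      have h2 := congrArg conjTranspose h1
      simp only [conjTranspose_mul, hA.eq, hRP.1.eq] at h2
      rw [Commute, SemiconjBy, ← h1, mul_assoc, h2]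
    have hQB : Q * B = B := by
      apply Matrix.ext_of_mulVec_single
      intro i
      rw [← mulVec_mulVec, hVQ _ (hBV _)]
    have hQR : Q * R = R := by rw [hR, ← Matrix.mul_assoc, hQB]
    have hRQ : R * Q = R := by
      have := congrArg conjTranspose hQR
      simpa only [conjTranspose_mul, hQ.1.eq, hRP.1.eq] using this
    have hcompress : ∀ A : Matrix (Fin d) (Fin d) ℂ, (R * A).trace = (Bᴴ * A * B).trace := by
      intro A
      rw [hR, Matrix.mul_assoc, Matrix.trace_mul_comm]
    have hcompress_mul : ∀ A C : Matrix (Fin d) (Fin d) ℂ, (∀ v ∈ V, C *ᵥ v ∈ V) →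
        Bᴴ * A * B * (Bᴴ * C * B) = Bᴴ * (A * C) * B := by
      intro A C hC
      have := hcol C hC
      calc Bᴴ * A * B * (Bᴴ * C * B) = Bᴴ * A * (R * (C * B)) := by
            simp only [hR, Matrix.mul_assoc]
        _ = _ := by rw [this]; simp only [Matrix.mul_assoc]
    have hproj : ∀ P : Matrix (Fin d) (Fin d) ℂ, IsProjn P → (∀ v ∈ V, P *ᵥ v ∈ V) →
        IsProjn (Bᴴ * P * B) := by
      intro P hP hPV
      refine ⟨?_, by rw [hcompress_mul _ _ hPV, hP.2]⟩
      show (Bᴴ * P * B)ᴴ = _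
      simp only [conjTranspose_mul, conjTranspose_conjTranspose, hP.1.eq, Matrix.mul_assoc]
    have hblock := blockBound_of_le_two hM hV2 (hproj P₁ h₁ hV₁) (hproj P₂ h₂ hV₂)
      (hproj P₃ h₃ hV₃)
    have hRtr : R.trace = m := by
      have := hcompress 1
      rw [mul_one, Matrix.mul_one, hB, Matrix.trace_one, Fintype.card_fin] at this
      exact this
    have hQRproj : IsProjn (Q - R) :=
      ⟨hQ.1.sub hRP.1, by rw [sub_mul, mul_sub, mul_sub, hQ.2, hQR, hRQ, hRP.2]; simp⟩
    have hrest := ih hQRproj (hQ₁.sub_left (hcomm P₁ h₁.1 hV₁))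
      (hQ₂.sub_left (hcomm P₂ h₂.1 hV₂)) (hQ₃.sub_left (hcomm P₃ h₃.1 hV₃)) (by
        have : (1 : ℝ) ≤ m := by exact_mod_cast hm1
        rw [Matrix.trace_sub, hRtr, Complex.sub_re, Complex.natCast_re]
        push_cast at hN
        linarith)
    have hoverlap : overlapSum α β γ 1 (Bᴴ * P₁ * B) (Bᴴ * P₂ * B) (Bᴴ * P₃ * B) =
        overlapSum α β γ R P₁ P₂ P₃ := by
      simp only [overlapSum, one_mul, hcompress_mul _ _ hV₂, hcompress_mul _ _ hV₃, hcompress]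
    rw [hoverlap, ← hcompress, ← hcompress, ← hcompress] at hblock
    have hm : (m : ℝ) = R.trace.re := by rw [hRtr, Complex.natCast_re]
    rw [hm] at hblock
    convert hblock.add hrest using 1 <;>
      simp only [overlapSum, sub_mul, Matrix.trace_sub, Complex.sub_re] <;> ring

/-! ### The linear program over block data -/

theorem BlockBound.le_or_le_or_le {α β γ M n k d F m : ℝ} (hα : α ≤ M) (hβ : β ≤ M) (hγ : γ ≤ M)
    (hsum : α + β + γ ≤ M) (hd : 2 * (n + k) ≤ d)
    (hm : m = min n (d - 2 * n - 2 * k))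
    (h : BlockBound α β γ M d n (n + k) (d - (n + k)) F) :
    F ≤ n * M ∨ F ≤ n * M + k * γ ∨ F ≤ (n - m) * M + m * β + (m + k) * γ := by
  obtain ⟨s, c, hs, hc, h1, h2, h3, h4, h5⟩ := h
  have c0 := hc 0 0 0
  have c1 := hc 0 0 1
  have c2 := hc 0 1 0
  have c3 := hc 0 1 1
  have c4 := hc 1 0 0
  have c5 := hc 1 0 1
  have c6 := hc 1 1 0
  have c7 := hc 1 1 1
  generalize c 0 0 0 = c000 at *
  generalize c 0 0 1 = c001 at *
  generalize c 0 1 0 = c010 at *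
  generalize c 0 1 1 = c011 at *
  generalize c 1 0 0 = c100 at *
  generalize c 1 0 1 = c101 at *
  generalize c 1 1 0 = c110 at *
  generalize c 1 1 1 = c111 at *
  clear hc
  have hsum2 : α + β + γ ≤ 2 * M := by linarith
  rcases le_total c011 c100 with hle | hle
  · left
    have e1 := mul_le_mul_of_nonneg_left hα c6
    have e2 := mul_le_mul_of_nonneg_left hβ c5
    have e3 := mul_le_mul_of_nonneg_left hγ c3
    have e4 := mul_le_mul_of_nonneg_left hsum c0
    have e5 := mul_le_mul_of_nonneg_left hsum2 (sub_nonneg.mpr hle)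
    have hj : c111 = c000 + (c100 - c011) := by linarith
    have hn : n * M = s * M + c110 * M + c101 * M + c011 * M + c000 * M
        + (c100 - c011) * (2 * M) := by
      have : n = s + c110 + c101 + c011 + c000 + 2 * (c100 - c011) := by linarith
      rw [this]
      ring
    have hF : c111 * (α + β + γ) = c000 * (α + β + γ) + (c100 - c011) * (α + β + γ) := by
      rw [hj]
      ring
    linarith
  have hbase : F ≤ (s + c111 + c100) * M + c110 * α + c101 * β + (c011 - c100) * γ := by
    have e1 := mul_le_mul_of_nonneg_left hsum c7
    have e2 := mul_le_mul_of_nonneg_left hγ c4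
    linarith
  rcases le_total (c011 - c100) k with hk | hk
  · have e1 := mul_le_mul_of_nonneg_left hα c6
    have e2 := mul_le_mul_of_nonneg_left hβ c5
    have hn : n * M = s * M + c111 * M + c100 * M + c110 * M + c101 * M := by
      rw [h2]
      ring
    rcases le_total γ 0 with hγ0 | hγ0
    · left
      have e3 := mul_nonpos_of_nonneg_of_nonpos (sub_nonneg.mpr hle) hγ0
      linarith
    · right
      left
      have e3 := mul_le_mul_of_nonneg_right hk hγ0
      linarith
  right
  set y := min c110 (c011 - c100 - k) with hy
  have hy0 : 0 ≤ y := le_min c6 (by linarith)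
  have hy1 : y ≤ c110 := min_le_left _ _
  have hy2 : y ≤ c011 - c100 - k := min_le_right _ _
  set e := c011 - c100 - k - y with he
  have he0 : 0 ≤ e := by linarith
  have hem : e ≤ m := by
    rw [hm]
    refine le_min (by linarith) ?_
    rcases min_choice c110 (c011 - c100 - k) with hc | hc
    · rw [← hy] at hc
      linarith
    · rw [← hy] at hc
      linarith
  have hbound : F ≤ (n - e) * M + e * β + (e + k) * γ := by
    have e1 := mul_le_mul_of_nonneg_left hsum2 hy0
    have e2 := mul_le_mul_of_nonneg_left hα (sub_nonneg.mpr hy1)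
    have e3 := mul_le_mul_of_nonneg_left hβ (show 0 ≤ c101 - y - e by linarith)
    have hn : (n - e) * M = (s + c111 + c100) * M + y * (2 * M) + (c110 - y) * M
        + (c101 - y - e) * M := by
      rw [h2]
      ring
    have hg : (c011 - c100) * γ = y * γ + (e + k) * γ := by
      rw [he]
      ring
    linarith
  rcases le_total (β + γ) M with hM | hM
  · left
    have := mul_le_mul_of_nonneg_left hM he0
    linarith
  · right
    have := mul_le_mul_of_nonneg_left hM (sub_nonneg.mpr hem)
    linarith

/-! ### Separation -/

/-- A point outside a compact convex subset of `ℝ³` is strictly separated from it by a linear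
functional whose last two coefficients are nonzero. -/
theorem exists_separating_of_notMem {K : Set (ℝ × ℝ × ℝ)} (hK : IsCompact K) (hconv : Convex ℝ K)
    {x : ℝ × ℝ × ℝ} (hx : x ∉ K) :
    ∃ α β γ : ℝ, β ≠ 0 ∧ γ ≠ 0 ∧ ∀ y ∈ K,
      α * y.1 + β * y.2.1 + γ * y.2.2 < α * x.1 + β * x.2.1 + γ * x.2.2 := by
  obtain ⟨f, u, hfK, hfx⟩ := geometric_hahn_banach_closed_point hconv hK.isClosed hx
  have hf : ∀ y : ℝ × ℝ × ℝ, f y = f (1, 0, 0) * y.1 + f (0, 1, 0) * y.2.1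
      + f (0, 0, 1) * y.2.2 := by
    intro y
    have : y = y.1 • ((1, 0, 0) : ℝ × ℝ × ℝ) + y.2.1 • ((0, 1, 0) : ℝ × ℝ × ℝ)
        + y.2.2 • ((0, 0, 1) : ℝ × ℝ × ℝ) := by
      ext <;> simp
    conv_lhs => rw [this]
    simp only [map_add, map_smul, smul_eq_mul]
    ring
  obtain ⟨C, hC⟩ := hK.exists_bound_of_continuousOn
    (f := fun y : ℝ × ℝ × ℝ => (y.1 + y.2.1 + y.2.2) - (x.1 + x.2.1 + x.2.2)) (by fun_prop)
  set α := f (1, 0, 0)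
  set β := f (0, 1, 0)
  set γ := f (0, 0, 1)
  have hgap : 0 < (f x - u) / (|C| + 1) := div_pos (sub_pos.mpr hfx) (by positivity)
  obtain ⟨ε, ⟨hε0, hε1⟩, hε⟩ := (Set.Ioo_infinite hgap).exists_notMem_finset {-β, -γ}
  simp only [Finset.mem_insert, Finset.mem_singleton, not_or] at hε
  refine ⟨α + ε, β + ε, γ + ε, fun h => hε.1 (by linarith), fun h => hε.2 (by linarith),
    fun y hy => ?_⟩
  have h1 := hfK y hy
  have h2 := (le_abs_self _).trans ((hC y hy).trans (le_abs_self C))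
  rw [hf] at h1
  rw [lt_div_iff₀ (by positivity), hf x] at hε1
  have h3 := mul_le_mul_of_nonneg_left h2 hε0.le
  linarith

/-! ### Maximizers of the overlap sum -/

theorem IsProjn.conj_reflection {d : ℕ} {P R : Matrix (Fin d) (Fin d) ℂ} (hP : IsProjn P)
    (hR : R.IsHermitian) (hRR : R * R = 1) :
    IsProjn (R * P * R) ∧ (R * P * R).rank = P.rank := by
  have h : IsProjn (R * P * R) := by
    constructor
    · show (R * P * R)ᴴ = _
      simp only [conjTranspose_mul, hP.1.eq, hR.eq, mul_assoc]
    · calc R * P * R * (R * P * R) = R * P * (R * R) * P * R := by simp only [mul_assoc]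
        _ = R * (P * P) * R := by rw [hRR, mul_one]; simp only [mul_assoc]
        _ = R * P * R := by rw [hP.2]
  refine ⟨h, ?_⟩
  have ht : (R * P * R).trace = P.trace := by
    rw [Matrix.trace_mul_comm, ← mul_assoc, hRR, one_mul]
  rw [h.trace_eq_rank, hP.trace_eq_rank] at ht
  exact_mod_cast ht

theorem commute_of_overlapSum_max {α β γ : ℝ} {d : ℕ} {P₁ P₂ P₃ : Matrix (Fin d) (Fin d) ℂ}
    (h₁ : IsProjn P₁) (h₂ : IsProjn P₂) (h₃ : IsProjn P₃)
    (hmax : ∀ P₁' P₂' : Matrix (Fin d) (Fin d) ℂ, IsProjn P₁' → IsProjn P₂' →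
      P₁'.rank = P₁.rank → P₂'.rank = P₂.rank →
      overlapSum α β γ 1 P₁' P₂' P₃ ≤ overlapSum α β γ 1 P₁ P₂ P₃) :
    Commute P₁ ((α : ℂ) • P₂ + (β : ℂ) • P₃) ∧ Commute P₂ ((α : ℂ) • P₁ + (γ : ℂ) • P₃) := by
  have hherm : ∀ (a b : ℝ) (P Q : Matrix (Fin d) (Fin d) ℂ), IsProjn P → IsProjn Q →
      ((a : ℂ) • P + (b : ℂ) • Q).IsHermitian := by
    intro a b P Q hP hQ
    show ((a : ℂ) • P + (b : ℂ) • Q)ᴴ = _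
    simp [conjTranspose_add, conjTranspose_smul, hP.1.eq, hQ.1.eq]
  constructor
  · refine h₁.commute_of_reflection_le (hherm α β P₂ P₃ h₂ h₃) fun R hR hRR => ?_
    obtain ⟨hc, hr⟩ := h₁.conj_reflection hR hRR
    have := hmax _ P₂ hc h₂ hr rfl
    simp only [overlapSum, one_mul] at this
    simp only [mul_add, Matrix.mul_smul, Matrix.trace_add, Matrix.trace_smul, smul_eq_mul,
      Complex.add_re, Complex.re_ofReal_mul]
    linarith
  · refine h₂.commute_of_reflection_le (hherm α γ P₁ P₃ h₁ h₃) fun R hR hRR => ?_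
    obtain ⟨hc, hr⟩ := h₂.conj_reflection hR hRR
    have := hmax P₁ _ h₁ hc rfl hr
    simp only [overlapSum, one_mul] at this
    simp only [mul_add, Matrix.mul_smul, Matrix.trace_add, Matrix.trace_smul, smul_eq_mul,
      Complex.add_re, Complex.re_ofReal_mul, Matrix.trace_mul_comm _ P₁]
    linarith

theorem blockBound_of_overlapSum_max {α β γ M : ℝ} (hβ : β ≠ 0) (hγ : γ ≠ 0)
    (hM : ∀ p₁ p₂ p₃ : Matrix (Fin 2) (Fin 2) ℂ, IsProjn p₁ → IsProjn p₂ → IsProjn p₃ →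
      p₁.rank = 1 → p₂.rank = 1 → p₃.rank = 1 → overlapSum α β γ 1 p₁ p₂ p₃ ≤ M)
    {d : ℕ} {P₁ P₂ P₃ : Matrix (Fin d) (Fin d) ℂ}
    (h₁ : IsProjn P₁) (h₂ : IsProjn P₂) (h₃ : IsProjn P₃)
    (hmax : ∀ P₁' P₂' : Matrix (Fin d) (Fin d) ℂ, IsProjn P₁' → IsProjn P₂' →
      P₁'.rank = P₁.rank → P₂'.rank = P₂.rank →
      overlapSum α β γ 1 P₁' P₂' P₃ ≤ overlapSum α β γ 1 P₁ P₂ P₃) :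
    BlockBound α β γ M d P₁.rank P₂.rank P₃.rank (overlapSum α β γ 1 P₁ P₂ P₃) := by
  obtain ⟨hc₁, hc₂⟩ := commute_of_overlapSum_max h₁ h₂ h₃ hmax
  have hX₁ : Commute (((α * β : ℝ) : ℂ) • P₁ + ((α * γ : ℝ) : ℂ) • P₂
      + ((β * γ : ℝ) : ℂ) • P₃) P₁ := by
    have : ((α * β : ℝ) : ℂ) • P₁ + ((α * γ : ℝ) : ℂ) • P₂ + ((β * γ : ℝ) : ℂ) • P₃ =
        ((α * β : ℝ) : ℂ) • P₁ + (γ : ℂ) • ((α : ℂ) • P₂ + (β : ℂ) • P₃) := by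
      push_cast
      module
    rw [this]
    exact ((Commute.refl P₁).smul_left _).add_left (hc₁.symm.smul_left _)
  have hX₂ : Commute (((α * β : ℝ) : ℂ) • P₁ + ((α * γ : ℝ) : ℂ) • P₂
      + ((β * γ : ℝ) : ℂ) • P₃) P₂ := by
    have : ((α * β : ℝ) : ℂ) • P₁ + ((α * γ : ℝ) : ℂ) • P₂ + ((β * γ : ℝ) : ℂ) • P₃ =
        ((α * γ : ℝ) : ℂ) • P₂ + (β : ℂ) • ((α : ℂ) • P₁ + (γ : ℂ) • P₃) := by
      push_cast
      module
    rw [this]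
    exact ((Commute.refl P₂).smul_left _).add_left (hc₂.symm.smul_left _)
  have hw : ((β * γ : ℝ) : ℂ) ≠ 0 := by exact_mod_cast mul_ne_zero hβ hγ
  have h := blockBound_of_central hM h₁ h₂ h₃ hw hX₁ hX₂ d
    (Q := 1) ⟨Matrix.isHermitian_one, mul_one 1⟩ (Commute.one_left _) (Commute.one_left _)
    (Commute.one_left _) (by simp)
  simpa [h₁.trace_eq_rank, h₂.trace_eq_rank, h₃.trace_eq_rank] using h

theorem isProjn_single (i : Fin 2) :
    IsProjn (Matrix.single i i (1 : ℂ)) ∧ (Matrix.single i i (1 : ℂ)).rank = 1 := by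
  have h : IsProjn (Matrix.single i i (1 : ℂ)) := ⟨by simp [Matrix.IsHermitian], by simp⟩
  refine ⟨h, ?_⟩
  have ht := h.trace_eq_rank
  rw [Matrix.trace_single_eq_same] at ht
  exact_mod_cast ht.symm

/-- Lemma 3.13 (type II slices with the outcome of the third experiment reversed): if
`2(n+k) ≤ d`, then `S_d(n, n+k, d−(n+k))` lies in the convex hull of
`max(0,(6n+4k−2d)/d)·S₂(1) + {a}` and `(2n/d)·S₂(1) + {0}×{0}×[0, k/d]`, where
`a = (0, min(n, d−2n−2k)/d, (min(n, d−2n−2k)+k)/d)`. -/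
theorem corrSet_typeII_swapped (n k d : ℕ) (hn : 0 < n) (hk : 0 < k) (hd : 0 < d)
    (h : 2 * (n + k) ≤ d) :
    corrSet d n (n + k) (d - (n + k)) ⊆
      convexHull ℝ
        (((max 0 ((6 * (n : ℝ) + 4 * (k : ℝ) - 2 * (d : ℝ)) / (d : ℝ))) •
              corrSet 2 1 1 1 +
            {((0 : ℝ), ((min n (d - 2 * n - 2 * k) : ℕ) : ℝ) / (d : ℝ),
              (((min n (d - 2 * n - 2 * k) : ℕ) : ℝ) + (k : ℝ)) / (d : ℝ))}) ∪
          (((2 * (n : ℝ)) / (d : ℝ)) • corrSet 2 1 1 1 +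
            ({(0 : ℝ)} ×ˢ ({(0 : ℝ)} ×ˢ Set.Icc (0 : ℝ) ((k : ℝ) / (d : ℝ)))))) := by
  intro x hx
  by_contra hxK
  have hS := isCompact_corrSet 2 1 1 1
  obtain ⟨α, β, γ, hβ0, hγ0, hsep⟩ := exists_separating_of_notMem
    (IsCompact.convexHull_of_finiteDimensional (((hS.smul _).add isCompact_singleton).union
      ((hS.smul _).add (isCompact_singleton.prod (isCompact_singleton.prod isCompact_Icc)))))
    (convex_convexHull ℝ _) hxK
  have hA := fun y hy => hsep y (subset_convexHull ℝ _ (Set.mem_union_left _ hy))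
  have hB := fun y hy => hsep y (subset_convexHull ℝ _ (Set.mem_union_right _ hy))
  have hg : Continuous fun y : ℝ × ℝ × ℝ => α * y.1 + β * y.2.1 + γ * y.2.2 := by fun_prop
  obtain ⟨hp, hpr⟩ := isProjn_single 0
  obtain ⟨hq, hqr⟩ := isProjn_single 1
  obtain ⟨e, he, hmaxe⟩ := hS.exists_isMaxOn
    ⟨_, _, _, _, hp, hp, hp, hpr, hpr, hpr, rfl⟩ hg.continuousOn
  set M := 2 * (α * e.1 + β * e.2.1 + γ * e.2.2) with hMe
  have hM : ∀ p₁ p₂ p₃ : Matrix (Fin 2) (Fin 2) ℂ, IsProjn p₁ → IsProjn p₂ → IsProjn p₃ →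
      p₁.rank = 1 → p₂.rank = 1 → p₃.rank = 1 → overlapSum α β γ 1 p₁ p₂ p₃ ≤ M := by
    intro p₁ p₂ p₃ h₁ h₂ h₃ r₁ r₂ r₃
    have hle := hmaxe ⟨p₁, p₂, p₃, h₁, h₂, h₃, r₁, r₂, r₃, rfl⟩
    simp only [Set.mem_ofPred_eq, Nat.cast_ofNat] at hle
    simp only [overlapSum, one_mul]
    linarith
  have hα : α ≤ M := by
    simpa [overlapSum] using hM _ _ _ hp hp hq hpr hpr hqr
  have hβ : β ≤ M := by
    simpa [overlapSum] using hM _ _ _ hp hq hp hpr hqr hpr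
  have hγ : γ ≤ M := by
    simpa [overlapSum] using hM _ _ _ hq hp hp hqr hpr hpr
  have hsum : α + β + γ ≤ M := by
    simpa [overlapSum] using hM _ _ _ hp hp hp hpr hpr hpr
  have hd0 : (0 : ℝ) < d := by exact_mod_cast hd
  obtain ⟨y, ⟨P₁, P₂, P₃, h₁, h₂, h₃, r₁, r₂, r₃, rfl⟩, hmaxy⟩ :=
    (isCompact_corrSet d n (n + k) (d - (n + k))).exists_isMaxOn ⟨x, hx⟩ hg.continuousOn
  have hxF : α * x.1 + β * x.2.1 + γ * x.2.2 ≤ overlapSum α β γ 1 P₁ P₂ P₃ / d := by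
    refine (hmaxy hx).trans_eq ?_
    simp only [overlapSum, one_mul]
    ring
  have hblock := blockBound_of_overlapSum_max hβ0 hγ0 hM h₁ h₂ h₃ fun P₁' P₂' h₁' h₂' r₁' r₂' => by
    have hle := hmaxy ⟨P₁', P₂', P₃, h₁', h₂', h₃, r₁'.trans r₁, r₂'.trans r₂, r₃, rfl⟩
    simp only [Set.mem_ofPred_eq] at hle
    refine le_of_mul_le_mul_left ?_ (one_div_pos.mpr hd0)
    simp only [overlapSum, one_mul]
    linarith
  rw [r₁, r₂, r₃, Nat.cast_sub (by omega), Nat.cast_add] at hblock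
  have hm : ((min n (d - 2 * n - 2 * k) : ℕ) : ℝ) = min (n : ℝ) (d - 2 * n - 2 * k) := by
    rw [Nat.cast_min, Nat.sub_sub, Nat.cast_sub (by omega)]
    push_cast
    rw [sub_sub]
  have hk0 : (0 : ℝ) ≤ k / d := by positivity
  rcases hblock.le_or_le_or_le hα hβ hγ hsum (by exact_mod_cast h) hm with hF | hF | hF
  · have := hB _ (Set.add_mem_add (Set.smul_mem_smul_set he)
      (show ((0 : ℝ), (0 : ℝ), (0 : ℝ)) ∈ _ from ⟨rfl, rfl, le_rfl, hk0⟩))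
    refine absurd ((this.trans_le hxF).trans_le (div_le_div_of_nonneg_right hF hd0.le)) ?_
    refine not_lt.mpr (le_of_eq ?_)
    simp only [Prod.fst_add, Prod.snd_add, Prod.smul_fst, Prod.smul_snd, smul_eq_mul]
    rw [hMe]
    field_simp
    ring
  · have := hB _ (Set.add_mem_add (Set.smul_mem_smul_set he)
      (show ((0 : ℝ), (0 : ℝ), (k / d : ℝ)) ∈ _ from ⟨rfl, rfl, hk0, le_rfl⟩))
    refine absurd ((this.trans_le hxF).trans_le (div_le_div_of_nonneg_right hF hd0.le)) ?_
    refine not_lt.mpr (le_of_eq ?_)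
    simp only [Prod.fst_add, Prod.snd_add, Prod.smul_fst, Prod.smul_snd, smul_eq_mul]
    rw [hMe]
    field_simp
    ring
  · have hcoef : max 0 ((6 * (n : ℝ) + 4 * (k : ℝ) - 2 * (d : ℝ)) / (d : ℝ)) =
        2 * (n - ((min n (d - 2 * n - 2 * k) : ℕ) : ℝ)) / d := by
      rw [hm]
      rcases le_total (n : ℝ) (d - 2 * n - 2 * k) with hle | hle
      · rw [min_eq_left hle, max_eq_left (div_nonpos_of_nonpos_of_nonneg (by linarith) hd0.le)]
        simp
      · rw [min_eq_right hle, max_eq_right (div_nonneg (by linarith) hd0.le)]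
        ring
    have := hA _ (Set.add_mem_add (Set.smul_mem_smul_set he) rfl)
    rw [hcoef] at this
    refine absurd ((this.trans_le hxF).trans_le (div_le_div_of_nonneg_right hF hd0.le)) ?_
    refine not_lt.mpr (le_of_eq ?_)
    simp only [Prod.fst_add, Prod.snd_add, Prod.smul_fst, Prod.smul_snd, smul_eq_mul]
    rw [hMe]
    field_simp
    ring
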